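/- Let φ:(0,∞)→ℝ be C², define μ₂(V) = φ''(a_V) + (7/a_V)φ'(a_V) with a_V = (6√2 V)^{1/3}, and suppose μ₂(V₂) = 0 and μ₂'(V₂) ≠ 0 for some V₂ > 0. Then for every ε > 0 there exist V > 0, λ ∈ ℝ, and a solution of the first-order conditions g(a) = 288V², ∇E(a) + λ∇g(a) = 0 of the form a = (a, b, b, a, b, b) with a ≠ b, satisfying |V − V₂| + |λ − λ_{V₂}| + max(|a − a_{V₂}|, |b − a_{V₂}|) < ε. -/

import Mathlib

/-- Cayley–Menger determinant of the edge data `(a,b,c,A,B,C)` of a tetrahedron,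
where `a,b,c` are the edges from one vertex and `A,B,C` the opposite edges. -/
noncomputable def cayleyMenger (a b c A B C : ℝ) : ℝ :=
  Matrix.det !![0, a ^ 2, b ^ 2, c ^ 2, 1;
                a ^ 2, 0, C ^ 2, B ^ 2, 1;
                b ^ 2, C ^ 2, 0, A ^ 2, 1;
                c ^ 2, B ^ 2, A ^ 2, 0, 1;
                1, 1, 1, 1, 0]

/-- Total energy of the four-particle system. -/
noncomputable def tetE (φ : ℝ → ℝ) (x : Fin 6 → ℝ) : ℝ := ∑ i, φ (x i)

/-- Volume constraint function of the four-particle system. -/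
noncomputable def tetG (x : Fin 6 → ℝ) : ℝ :=
  cayleyMenger (x 0) (x 1) (x 2) (x 3) (x 4) (x 5)

/-- First-order (Lagrange) conditions for the tetrahedron problem:
`g(a) = 288V²` and `∇E(a) + λ∇g(a) = 0`. -/
noncomputable def tetFOC (φ : ℝ → ℝ) (V lam : ℝ) (x : Fin 6 → ℝ) : Prop :=
  tetG x = 288 * V ^ 2 ∧
  fderiv ℝ (tetE φ) x + lam • fderiv ℝ tetG x = 0

theorem tetG_expand (x : Fin 6 → ℝ) : tetG x =
    -2 * (x 0 ^ 2) * (x 3 ^ 2) * (x 0 ^ 2 + x 3 ^ 2) - 2 * (x 1 ^ 2) * (x 4 ^ 2) * (x 1 ^ 2 + x 4 ^ 2)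
    - 2 * (x 2 ^ 2) * (x 5 ^ 2) * (x 2 ^ 2 + x 5 ^ 2)
    + 2 * (x 0 ^ 2) * (x 3 ^ 2) * (x 1 ^ 2 + x 4 ^ 2 + x 2 ^ 2 + x 5 ^ 2)
    + 2 * (x 1 ^ 2) * (x 4 ^ 2) * (x 0 ^ 2 + x 3 ^ 2 + x 2 ^ 2 + x 5 ^ 2)
    + 2 * (x 2 ^ 2) * (x 5 ^ 2) * (x 0 ^ 2 + x 3 ^ 2 + x 1 ^ 2 + x 4 ^ 2)
    - 2 * (x 0 ^ 2 * x 1 ^ 2 * x 5 ^ 2 + x 0 ^ 2 * x 2 ^ 2 * x 4 ^ 2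
      + x 1 ^ 2 * x 2 ^ 2 * x 3 ^ 2 + x 3 ^ 2 * x 4 ^ 2 * x 5 ^ 2) := by
  unfold tetG cayleyMenger
  simp [Matrix.det_succ_row_zero, Fin.sum_univ_succ, Fin.succAbove]
  ring

theorem tetG_diff : Differentiable ℝ tetG := by
  have : tetG = _ := funext tetG_expand
  rw [this]
  fun_prop

theorem quartic_deriv (c0 c1 c2 p : ℝ) :
    HasDerivAt (fun t : ℝ => c0 + c1 * (p + t) ^ 2 + c2 * (p + t) ^ 4)
      (2 * c1 * p + 4 * c2 * p ^ 3) 0 := by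
  have h : HasDerivAt (fun t : ℝ => p + t) 1 0 := (hasDerivAt_id (0 : ℝ)).const_add p
  have := (((h.pow 2).const_mul c1).const_add c0).add ((h.pow 4).const_mul c2)
  refine HasDerivAt.congr_deriv this ?_
  simp
  ring

theorem tetG_dir (x v : Fin 6 → ℝ) (c0 c1 c2 p : ℝ)
    (h : ∀ t : ℝ, tetG (x + t • v) = c0 + c1 * (p + t) ^ 2 + c2 * (p + t) ^ 4) :
    fderiv ℝ tetG x v = 2 * c1 * p + 4 * c2 * p ^ 3 := by
  have h1 : HasLineDerivAt ℝ tetG (fderiv ℝ tetG x v) x v :=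
    (tetG_diff x).hasFDerivAt.hasLineDerivAt v
  have h2 : HasLineDerivAt ℝ tetG (2 * c1 * p + 4 * c2 * p ^ 3) x v := by
    unfold HasLineDerivAt
    rw [funext h]
    exact quartic_deriv c0 c1 c2 p
  exact HasDerivAt.unique h1 h2

theorem tetE_dir (φ : ℝ → ℝ) (x v : Fin 6 → ℝ) (h : ∀ i, DifferentiableAt ℝ φ (x i)) :
    fderiv ℝ (tetE φ) x v = ∑ i, deriv φ (x i) * v i := by
  have h1 : HasFDerivAt (tetE φ)
      (∑ i, deriv φ (x i) • (ContinuousLinearMap.proj i : (Fin 6 → ℝ) →L[ℝ] ℝ)) x := by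
    unfold tetE
    refine HasFDerivAt.fun_sum fun i _ => ?_
    exact (h i).hasDerivAt.comp_hasFDerivAt x
      (ContinuousLinearMap.proj i : (Fin 6 → ℝ) →L[ℝ] ℝ).hasFDerivAt
  rw [h1.fderiv]
  simp

theorem foc_of (φ : ℝ → ℝ) (a b V lam : ℝ) (hda : DifferentiableAt ℝ φ a)
    (hdb : DifferentiableAt ℝ φ b) (hV : 4 * a ^ 4 * (2 * b ^ 2 - a ^ 2) = 288 * V ^ 2)
    (h1 : deriv φ a + lam * (16 * a ^ 3 * b ^ 2 - 12 * a ^ 5) = 0)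
    (h2 : deriv φ b + lam * (4 * a ^ 4 * b) = 0) :
    tetFOC φ V lam ![a, b, b, a, b, b] := by
  refine ⟨?_, ?_⟩
  · rw [← hV, tetG_expand]
    simp
    ring
  · have hd : ∀ i, DifferentiableAt ℝ φ ((![a, b, b, a, b, b] : Fin 6 → ℝ) i) := by
      intro i
      fin_cases i <;> simpa
    have hA : ∀ v : Fin 6 → ℝ, (v = Pi.single 0 1 ∨ v = Pi.single 3 1) →
        fderiv ℝ tetG ![a, b, b, a, b, b] v = 16 * a ^ 3 * b ^ 2 - 12 * a ^ 5 := by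
      intro v hv
      rw [tetG_dir _ v 0 (2 * a ^ 2 * (4 * b ^ 2 - a ^ 2)) (-2 * a ^ 2) a]
      · ring
      · intro t
        rw [tetG_expand]
        rcases hv with rfl | rfl <;> simp [Pi.single_apply] <;> ring
    have hB : ∀ v : Fin 6 → ℝ, (v = Pi.single 1 1 ∨ v = Pi.single 2 1 ∨
        v = Pi.single 4 1 ∨ v = Pi.single 5 1) →
        fderiv ℝ tetG ![a, b, b, a, b, b] v = 4 * a ^ 4 * b := by
      intro v hv
      rw [tetG_dir _ v (6 * a ^ 4 * b ^ 2 - 4 * a ^ 6 - 2 * b ^ 6)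
        (2 * a ^ 4 + 4 * b ^ 4) (-2 * b ^ 2) b]
      · ring
      · intro t
        rw [tetG_expand]
        rcases hv with rfl | rfl | rfl | rfl <;> simp [Pi.single_apply] <;> ring
    have key : ∀ i : Fin 6, (fderiv ℝ (tetE φ) ![a, b, b, a, b, b] +
        lam • fderiv ℝ tetG ![a, b, b, a, b, b]) (Pi.single i 1) = 0 := by
      intro i
      rw [add_apply, smul_apply, tetE_dir φ _ _ hd]
      fin_cases i
      · simp [Pi.single_apply]
        rw [hA _ (by simp)]; exact h1
      · simp [Pi.single_apply]
        rw [hB _ (by simp)]; exact h2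
      · simp [Pi.single_apply]
        rw [hB _ (by simp)]; exact h2
      · simp [Pi.single_apply]
        rw [hA _ (by simp)]; exact h1
      · simp [Pi.single_apply]
        rw [hB _ (by simp)]; exact h2
      · simp [Pi.single_apply]
        rw [hB _ (by simp)]; exact h2
    apply ContinuousLinearMap.coe_injective
    apply LinearMap.pi_ext'
    intro i
    apply LinearMap.ext_ring
    simpa using key i

/-- derivative in the splitting parameter -/
theorem F_deriv (ψ : ℝ → ℝ) (t : ℝ) (h : DifferentiableAt ℝ ψ t) (d : ℝ) :
    HasDerivAt (fun δ : ℝ => d * ((t + δ) * t * ψ (t + δ) - (4 * t ^ 2 - 3 * (t + δ) ^ 2) * ψ t))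
      (d * (t ^ 2 * deriv ψ t + 7 * t * ψ t)) 0 := by
  have h0 : HasDerivAt (fun δ : ℝ => t + δ) 1 0 := (hasDerivAt_id (0 : ℝ)).const_add t
  have hψ : HasDerivAt (fun δ : ℝ => ψ (t + δ)) (deriv ψ t) 0 := by
    have : HasDerivAt ψ (deriv ψ t) (t + 0) := by simpa using h.hasDerivAt
    exact (this.comp (0 : ℝ) h0).congr_deriv (by simp)
  have := ((((h0.mul_const t).mul hψ).sub
    ((((h0.pow 2).const_mul 3).const_sub (4 * t ^ 2)).mul_const (ψ t))).const_mul d)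
  refine HasDerivAt.congr_deriv this ?_
  simp
  left
  ring

theorem pos_right (f : ℝ → ℝ) (c : ℝ) (hf : HasDerivAt f c 0) (h0 : f 0 = 0) (hc : 0 < c) :
    ∀ᶠ δ in nhdsWithin (0 : ℝ) (Set.Ioi 0), 0 < f δ := by
  have h := (hasDerivAt_iff_tendsto_slope.1 hf).mono_left
    (nhdsWithin_mono (0 : ℝ) (fun x (hx : x ∈ Set.Ioi (0 : ℝ)) => ne_of_gt hx))
  filter_upwards [h.eventually (lt_mem_nhds hc), self_mem_nhdsWithin] with δ h1 h2
  have h2' : (0 : ℝ) < δ := h2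
  rw [slope_def_field, h0, sub_zero, sub_zero] at h1
  exact (div_pos_iff_of_pos_right h2').1 h1

/-- If `μ₂(V₂) = 0` and `μ₂'(V₂) ≠ 0`, where `μ₂(V) = φ''(a_V) + (7/a_V)φ'(a_V)`,
then arbitrarily close to the trivial solution at `V₂` there are solutions of the
first-order conditions of the form `(a, b, b, a, b, b)` with `a ≠ b`. -/
theorem stmt_18 (φ : ℝ → ℝ) (hφ : ContDiffOn ℝ 2 φ (Set.Ioi 0))
    (aOf μ₂ : ℝ → ℝ)
    (haOf : ∀ V : ℝ, aOf V = (6 * Real.sqrt 2 * V) ^ ((1 : ℝ) / 3))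
    (hμ₂ : ∀ V : ℝ, μ₂ V = deriv (deriv φ) (aOf V) + 7 / aOf V * deriv φ (aOf V))
    (V₂ : ℝ) (hV₂ : 0 < V₂) (hμ0 : μ₂ V₂ = 0) (hμ' : deriv μ₂ V₂ ≠ 0)
    (a₂ lam₂ : ℝ) (ha₂ : a₂ = aOf V₂) (hlam₂ : lam₂ = -(deriv φ a₂) / (4 * a₂ ^ 5)) :
    ∀ ε : ℝ, 0 < ε →
      ∃ V lam a b : ℝ, 0 < V ∧ 0 < a ∧ 0 < b ∧
        tetFOC φ V lam ![a, b, b, a, b, b] ∧ a ≠ b ∧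
        |V - V₂| + |lam - lam₂| + max |a - a₂| |b - a₂| < ε := by
  intro ε hε
  have hV₂a : 0 < 6 * Real.sqrt 2 * V₂ := by positivity
  have ha₂pos : 0 < a₂ := by
    rw [ha₂, haOf]; exact Real.rpow_pos_of_pos hV₂a _
  have ha₂cube : a₂ ^ 3 = 6 * Real.sqrt 2 * V₂ := by
    rw [ha₂, haOf, ← Real.rpow_natCast, ← Real.rpow_mul hV₂a.le]
    norm_num
  have hψ : ContDiffOn ℝ 1 (deriv φ) (Set.Ioi 0) :=
    hφ.deriv_of_isOpen isOpen_Ioi (by norm_num)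
  have hφd : ∀ t : ℝ, 0 < t → DifferentiableAt ℝ φ t := fun t ht =>
    (hφ.differentiableOn (by norm_num)).differentiableAt (Ioi_mem_nhds ht)
  have hψd : ∀ t : ℝ, 0 < t → DifferentiableAt ℝ (deriv φ) t := fun t ht =>
    (hψ.differentiableOn (by norm_num)).differentiableAt (Ioi_mem_nhds ht)
  generalize hψe : deriv φ = ψ at *
  have hψc : ∀ t : ℝ, 0 < t → ContinuousAt ψ t := fun t ht => (hψd t ht).continuousAt
  -- the neighbourhood
  have hnear : ∀ᶠ q : ℝ × ℝ in nhds (a₂, a₂), 0 < q.1 ∧ 0 < q.2 ∧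
      0 < 4 * q.1 ^ 4 * (2 * q.2 ^ 2 - q.1 ^ 2) ∧
      |Real.sqrt (4 * q.1 ^ 4 * (2 * q.2 ^ 2 - q.1 ^ 2) / 288) - V₂|
        + |-(ψ q.2) / (4 * q.1 ^ 4 * q.2) - lam₂| + max |q.1 - a₂| |q.2 - a₂| < ε := by
    have e1 : ∀ᶠ q : ℝ × ℝ in nhds (a₂, a₂), 0 < q.1 :=
      continuousAt_fst.eventually (lt_mem_nhds ha₂pos)
    have e2 : ∀ᶠ q : ℝ × ℝ in nhds (a₂, a₂), 0 < q.2 :=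
      continuousAt_snd.eventually (lt_mem_nhds ha₂pos)
    have e3 : ∀ᶠ q : ℝ × ℝ in nhds (a₂, a₂), 0 < 4 * q.1 ^ 4 * (2 * q.2 ^ 2 - q.1 ^ 2) := by
      have hc : ContinuousAt (fun q : ℝ × ℝ => 4 * q.1 ^ 4 * (2 * q.2 ^ 2 - q.1 ^ 2)) (a₂, a₂) := by
        fun_prop
      refine hc.eventually (lt_mem_nhds ?_)
      have : 4 * a₂ ^ 4 * (2 * a₂ ^ 2 - a₂ ^ 2) = 4 * a₂ ^ 6 := by ring
      simp only [this]
      positivity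
    have e4 : ∀ᶠ q : ℝ × ℝ in nhds (a₂, a₂),
        |Real.sqrt (4 * q.1 ^ 4 * (2 * q.2 ^ 2 - q.1 ^ 2) / 288) - V₂|
        + |-(ψ q.2) / (4 * q.1 ^ 4 * q.2) - lam₂| + max |q.1 - a₂| |q.2 - a₂| < ε := by
      have hp : ContinuousAt (fun q : ℝ × ℝ => ψ q.2) (a₂, a₂) :=
        ContinuousAt.comp (f := Prod.snd) (g := ψ) (hψc a₂ ha₂pos) continuousAt_snd
      have hl : ContinuousAt (fun q : ℝ × ℝ => -(ψ q.2) / (4 * q.1 ^ 4 * q.2)) (a₂, a₂) := by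
        refine ContinuousAt.div hp.neg (by fun_prop) ?_
        simp only
        positivity
      have hs : ContinuousAt (fun q : ℝ × ℝ =>
          Real.sqrt (4 * q.1 ^ 4 * (2 * q.2 ^ 2 - q.1 ^ 2) / 288)) (a₂, a₂) := by
        fun_prop
      have hm : ContinuousAt (fun q : ℝ × ℝ => max |q.1 - a₂| |q.2 - a₂|) (a₂, a₂) := by
        fun_prop
      have hc := ((hs.sub_const V₂).abs.add (hl.sub_const lam₂).abs).add hm
      refine hc.eventually (gt_mem_nhds ?_)
      have s1 : Real.sqrt (4 * a₂ ^ 4 * (2 * a₂ ^ 2 - a₂ ^ 2) / 288) = V₂ := by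
        have : 4 * a₂ ^ 4 * (2 * a₂ ^ 2 - a₂ ^ 2) / 288 = V₂ ^ 2 := by
          have h2 : Real.sqrt 2 ^ 2 = 2 := Real.sq_sqrt (by norm_num)
          have : 4 * a₂ ^ 4 * (2 * a₂ ^ 2 - a₂ ^ 2) / 288 = (a₂ ^ 3) ^ 2 / 72 := by ring
          rw [this, ha₂cube, mul_pow, mul_pow, h2]
          ring
        rw [this, Real.sqrt_sq hV₂.le]
      have s2 : -(ψ a₂) / (4 * a₂ ^ 4 * a₂) = lam₂ := by
        rw [hlam₂]; congr 1; ring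
      simp [s1, s2, hε]
    filter_upwards [e1, e2, e3, e4] with q h1 h2 h3 h4 using ⟨h1, h2, h3, h4⟩
  obtain ⟨η, hη, hball⟩ := Metric.eventually_nhds_iff.1 hnear
  replace hball : ∀ a b : ℝ, |a - a₂| < η → |b - a₂| < η → _ := fun a b h1 h2 =>
    hball (y := (a, b)) (by
      rw [Prod.dist_eq, Real.dist_eq, Real.dist_eq]; exact max_lt h1 h2)
  -- sign change
  set d := deriv μ₂ V₂ with hd
  have hder : HasDerivAt μ₂ d V₂ :=
    (differentiableAt_of_deriv_ne_zero hμ').hasDerivAt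
  have hac : ContinuousAt aOf V₂ := by
    have : aOf = _ := funext haOf
    rw [this]
    exact ContinuousAt.rpow_const (by fun_prop) (Or.inl hV₂a.ne')
  have hac' : ∀ᶠ V in nhds V₂, |aOf V - a₂| < η / 2 := by
    have := hac.eventually (Metric.ball_mem_nhds (aOf V₂) (half_pos hη))
    filter_upwards [this] with V hV
    rw [ha₂]; simpa [Real.dist_eq] using hV
  have cP : HasDerivAt (fun h : ℝ => V₂ + h) 1 0 := (hasDerivAt_id (0 : ℝ)).const_add V₂
  have cM : HasDerivAt (fun h : ℝ => V₂ - h) (-1) 0 := (hasDerivAt_id (0 : ℝ)).const_sub V₂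
  have hdd : 0 < d * d := mul_self_pos.2 hμ'
  have hP : ∀ᶠ h in nhdsWithin (0 : ℝ) (Set.Ioi 0), 0 < d * μ₂ (V₂ + h) := by
    refine pos_right _ (d * d) ?_ (by simp [hμ0]) hdd
    have : HasDerivAt μ₂ d (V₂ + 0) := by simpa using hder
    simpa using (this.comp (0 : ℝ) cP).const_mul d
  have hM : ∀ᶠ h in nhdsWithin (0 : ℝ) (Set.Ioi 0), 0 < (-d) * μ₂ (V₂ - h) := by
    refine pos_right _ (d * d) ?_ (by simp [hμ0]) hdd
    have : HasDerivAt μ₂ d (V₂ - 0) := by simpa using hder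
    simpa using (this.comp (0 : ℝ) cM).const_mul (-d)
  have hPn : ∀ᶠ h in nhdsWithin (0 : ℝ) (Set.Ioi 0), |aOf (V₂ + h) - a₂| < η / 2 := by
    have hc := cP.continuousAt
    have := Filter.Tendsto.eventually (p := fun V => |aOf V - a₂| < η / 2) hc (by simpa using hac')
    exact nhdsWithin_le_nhds this
  have hMn : ∀ᶠ h in nhdsWithin (0 : ℝ) (Set.Ioi 0), |aOf (V₂ - h) - a₂| < η / 2 := by
    have hc := cM.continuousAt
    have := Filter.Tendsto.eventually (p := fun V => |aOf V - a₂| < η / 2) hc (by simpa using hac')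
    exact nhdsWithin_le_nhds this
  obtain ⟨h, h1, h2, h3, h4⟩ := (hP.and (hM.and (hPn.and hMn))).exists
  rw [hμ₂] at h1 h2
  generalize aOf (V₂ + h) = t₁ at *
  generalize aOf (V₂ - h) = t₂ at *
  have pos_of : ∀ t : ℝ, |t - a₂| < η → 0 < t := fun t ht => (hball t t ht ht).1
  have t1p : 0 < t₁ := pos_of t₁ (by linarith)
  have t2p : 0 < t₂ := pos_of t₂ (by linarith)
  let F : ℝ → ℝ → ℝ := fun t δ =>
    (t + δ) * t * ψ (t + δ) - (4 * t ^ 2 - 3 * (t + δ) ^ 2) * ψ t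
  have q1 : ∀ᶠ δ in nhdsWithin (0 : ℝ) (Set.Ioi 0), 0 < d * F t₁ δ := by
    refine pos_right _ _ (F_deriv ψ t₁ (hψd _ t1p) d) (by simp only [F, add_zero]; ring) ?_
    have : d * (t₁ ^ 2 * deriv ψ t₁ + 7 * t₁ * ψ t₁)
        = t₁ ^ 2 * (d * (deriv ψ t₁ + 7 / t₁ * ψ t₁)) := by
      field_simp
    rw [this]; positivity
  have q2 : ∀ᶠ δ in nhdsWithin (0 : ℝ) (Set.Ioi 0), 0 < (-d) * F t₂ δ := by
    refine pos_right _ _ (F_deriv ψ t₂ (hψd _ t2p) (-d)) (by simp only [F, add_zero]; ring) ?_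
    have : (-d) * (t₂ ^ 2 * deriv ψ t₂ + 7 * t₂ * ψ t₂)
        = t₂ ^ 2 * ((-d) * (deriv ψ t₂ + 7 / t₂ * ψ t₂)) := by
      field_simp
    rw [this]; exact mul_pos (by positivity) h2
  have q3 : ∀ᶠ δ in nhdsWithin (0 : ℝ) (Set.Ioi 0), δ < η / 2 :=
    nhdsWithin_le_nhds (gt_mem_nhds (half_pos hη))
  have q4 : ∀ᶠ δ in nhdsWithin (0 : ℝ) (Set.Ioi 0), 0 < δ := self_mem_nhdsWithin
  obtain ⟨δ, r1, r2, r3, r4⟩ := (q1.and (q2.and (q3.and q4))).exists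
  have hin : ∀ t ∈ Set.uIcc t₁ t₂, |t - a₂| < η / 2 := by
    intro t ht
    rw [abs_lt] at h3 h4 ⊢
    rcases Set.mem_uIcc.1 ht with ⟨u, v⟩ | ⟨u, v⟩ <;> constructor <;> linarith
  have hcont : ContinuousOn (fun t => d * F t δ) (Set.uIcc t₁ t₂) := by
    intro t ht
    have tp : 0 < t := pos_of t (by linarith [hin t ht])
    have k1 := hψc t tp
    have k2 : ContinuousAt (fun t => ψ (t + δ)) t :=
      ContinuousAt.comp (f := fun t => t + δ) (g := ψ) (hψc (t + δ) (by linarith)) (by fun_prop)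
    apply ContinuousAt.continuousWithinAt
    have k3 : ContinuousAt (fun t : ℝ => (t + δ) * t) t := by fun_prop
    have k4 : ContinuousAt (fun t : ℝ => 4 * t ^ 2 - 3 * (t + δ) ^ 2) t := by fun_prop
    exact ((k3.mul k2).sub (k4.mul k1)).const_mul d
  obtain ⟨t, ht, hF⟩ := intermediate_value_uIcc hcont
    (show (0 : ℝ) ∈ Set.uIcc (d * F t₁ δ) (d * F t₂ δ) from
      Set.mem_uIcc.2 (Or.inr ⟨by linarith, r1.le⟩))
  have hF0 : F t δ = 0 := (mul_eq_zero.1 hF).resolve_left hμ'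
  have htn := hin t ht
  have ht2 : |t + δ - a₂| < η := by
    rw [abs_lt] at htn ⊢; constructor <;> linarith
  obtain ⟨b1, b2, b3, b4⟩ := hball (t + δ) t ht2 (by linarith)
  simp only at b1 b2 b3 b4
  simp only [F] at hF0
  generalize hae : t + δ = a at *
  refine ⟨_, _, a, t, ?_, b1, b2, foc_of φ a t _ _ (hφd a b1) (hφd t b2) ?_ ?_ ?_, ?_, b4⟩
  · exact Real.sqrt_pos.2 (by positivity)
  · rw [Real.sq_sqrt (by positivity)]; ring
  · rw [hψe]
    field_simp
    linear_combination 4 * hF0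
  · rw [hψe]
    field_simp
    ring
  · exact fun hh => by linarith
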